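/- Let κ satisfy the energy, consistency, and domination principles, and suppose the topology of X has a countable base. Then for every μ ∈ E⁺ and every set A ⊂ X there exists a σ-compact (K_σ) set A' ⊂ A such that for every set L with A' ⊂ L ⊂ A one has κμ^{A'} = κμ^L = κμ^A everywhere on X, and hence μ^{A'} = μ^L = μ^A. -/

import Mathlib

open MeasureTheory Filter Topology Set
open scoped ENNReal NNReal

namespace Balayage

variable {X : Type*} [TopologicalSpace X] [T2Space X] [LocallyCompactSpace X]
  [MeasurableSpace X] [BorelSpace X]

/-- The potential `κμ(x) := ∫ κ(x,y) dμ(y)`. -/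
noncomputable def pot (κ : X → X → ℝ≥0∞) (μ : Measure X) (x : X) : ℝ≥0∞ :=
  ∫⁻ y, κ x y ∂μ

/-- The mutual energy `κ(μ,ν) := ∬ κ(x,y) d(μ⊗ν)(x,y)`. -/
noncomputable def energy (κ : X → X → ℝ≥0∞) (μ ν : Measure X) : ℝ≥0∞ :=
  ∫⁻ x, pot κ ν x ∂μ

/-- A positive Radon measure: locally finite and inner regular. -/
def IsRadon (μ : Measure X) : Prop :=
  μ.InnerRegular ∧ IsLocallyFiniteMeasure μ

/-- `E⁺`: the positive Radon measures of finite energy. -/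
def Eplus (κ : X → X → ℝ≥0∞) : Set (Measure X) :=
  {μ | IsRadon μ ∧ energy κ μ μ < ⊤}

/-- `μ` is concentrated on `A`: `A` is `μ`-measurable and `X∖A` is locally `μ`-negligible. -/
def ConcOn (μ : Measure X) (A : Set X) : Prop :=
  NullMeasurableSet A μ ∧ ∀ K : Set X, IsCompact K → μ (Aᶜ ∩ K) = 0

/-- `E⁺_A`: measures of finite energy concentrated on `A`. -/
def EplusOn (κ : X → X → ℝ≥0∞) (A : Set X) : Set (Measure X) :=
  {μ ∈ Eplus κ | ConcOn μ A}

/-- The inner capacity `c_*(A)`. -/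
noncomputable def innerCap (κ : X → X → ℝ≥0∞) (A : Set X) : ℝ≥0∞ :=
  (⨅ μ ∈ {μ ∈ EplusOn κ A | μ Set.univ = 1}, energy κ μ μ)⁻¹

/-- `P` holds nearly everywhere on `A`: the set where it fails has inner capacity zero. -/
def NEOn (κ : X → X → ℝ≥0∞) (A : Set X) (P : X → Prop) : Prop :=
  innerCap κ {x | x ∈ A ∧ ¬ P x} = 0

/-- The outer capacity `c^*(A)`. -/
noncomputable def outerCap (κ : X → X → ℝ≥0∞) (A : Set X) : ℝ≥0∞ :=
  ⨅ D ∈ {D : Set X | IsOpen D ∧ A ⊆ D}, innerCap κ D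

/-- `P` holds quasi-everywhere on `A`: the set where it fails has outer capacity zero. -/
def QEOn (κ : X → X → ℝ≥0∞) (A : Set X) (P : X → Prop) : Prop :=
  outerCap κ {x | x ∈ A ∧ ¬ P x} = 0

/-- The class `Λ_{A,μ}` of measures `ν ∈ E⁺` with `κν ≥ κμ` n.e. on `A`. -/
def InnerLam (κ : X → X → ℝ≥0∞) (A : Set X) (μ : Measure X) : Set (Measure X) :=
  {ν ∈ Eplus κ | NEOn κ A (fun x => pot κ μ x ≤ pot κ ν x)}

/-- The class `Λ*_{A,μ}` of measures `ν ∈ E⁺` with `κν ≥ κμ` q.e. on `A`. -/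
def OuterLam (κ : X → X → ℝ≥0∞) (A : Set X) (μ : Measure X) : Set (Measure X) :=
  {ν ∈ Eplus κ | QEOn κ A (fun x => pot κ μ x ≤ pot κ ν x)}

/-- `b` is the inner balayage `μ^A`: the measure of minimal potential in `Λ_{A,μ}`. -/
def IsInnerBal (κ : X → X → ℝ≥0∞) (A : Set X) (μ b : Measure X) : Prop :=
  b ∈ InnerLam κ A μ ∧ ∀ ν ∈ InnerLam κ A μ, ∀ x, pot κ b x ≤ pot κ ν x

/-- `b` is the outer balayage `μ^{*A}`: the measure of minimal potential in `Λ*_{A,μ}`. -/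
def IsOuterBal (κ : X → X → ℝ≥0∞) (A : Set X) (μ b : Measure X) : Prop :=
  b ∈ OuterLam κ A μ ∧ ∀ ν ∈ OuterLam κ A μ, ∀ x, pot κ b x ≤ pot κ ν x

/-- The strong (energy) distance `‖μ − ν‖`. -/
noncomputable def strDist (κ : X → X → ℝ≥0∞) (μ ν : Measure X) : ℝ :=
  Real.sqrt ((energy κ μ μ).toReal - 2 * (energy κ μ ν).toReal + (energy κ ν ν).toReal)

/-- The energy principle (strict positive definiteness). -/
def EnergyPrinciple (κ : X → X → ℝ≥0∞) : Prop :=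
  ∀ μ ∈ Eplus κ, ∀ ν ∈ Eplus κ,
    2 * energy κ μ ν ≤ energy κ μ μ + energy κ ν ν ∧
      (2 * energy κ μ ν = energy κ μ μ + energy κ ν ν → μ = ν)

/-- Vague convergence of a net of measures along a filter. -/
def VagueConv {ι : Type*} (F : Filter ι) (m : ι → Measure X) (ν : Measure X) : Prop :=
  ∀ f : X → ℝ, Continuous f → HasCompactSupport f →
    Tendsto (fun i => ∫ x, f x ∂(m i)) F (nhds (∫ x, f x ∂ν))

/-- A net of measures is strong Cauchy (for the energy metric) along a filter. -/
def StrongCauchy (κ : X → X → ℝ≥0∞) {ι : Type*} (F : Filter ι) (m : ι → Measure X) : Prop :=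
  ∀ ε : ℝ, 0 < ε → ∃ s ∈ F, ∀ i ∈ s, ∀ j ∈ s, strDist κ (m i) (m j) < ε

/-- The consistency principle: every strong Cauchy net in `E⁺` converges strongly
to each of its vague limit points. -/
def Consistent (κ : X → X → ℝ≥0∞) : Prop :=
  ∀ (ι : Type) (F : Filter ι) (m : ι → Measure X), F.NeBot →
    (∀ i, m i ∈ Eplus κ) → StrongCauchy κ F m →
    ∀ ν : Measure X, (∃ G : Filter ι, G ≤ F ∧ G.NeBot ∧ VagueConv G m ν) →
      Tendsto (fun i => strDist κ (m i) ν) F (nhds 0)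

/-- The domination principle. -/
def Domination (κ : X → X → ℝ≥0∞) : Prop :=
  ∀ μ ∈ Eplus κ, ∀ ν ∈ Eplus κ,
    (∀ᵐ x ∂μ, pot κ μ x ≤ pot κ ν x) → ∀ x, pot κ μ x ≤ pot κ ν x

/-- A kernel: symmetric and lower semicontinuous. -/
structure IsKernel (κ : X → X → ℝ≥0∞) : Prop where
  symm : ∀ x y, κ x y = κ y x
  lsc : LowerSemicontinuous (Function.uncurry κ)

/-- `E'_A`: the strong closure of `E⁺_A` within `E⁺`. -/
def EclosOn (κ : X → X → ℝ≥0∞) (A : Set X) : Set (Measure X) :=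
  {ν ∈ Eplus κ | ∀ ε : ℝ, 0 < ε → ∃ μ ∈ EplusOn κ A, strDist κ ν μ < ε}

/-- The (real-valued) potential of the signed measure `λ = lp − lm`. -/
noncomputable def spot (κ : X → X → ℝ≥0∞) (lp lm : Measure X) (x : X) : ℝ :=
  (pot κ lp x).toReal - (pot κ lm x).toReal

/-- Assumption (A2): every `f ∈ C_c(X)` is the limit, uniformly with supports in one fixed
compact set, of a sequence of potentials of signed measures of finite energy that are
continuous and compactly supported. -/
def A2 (κ : X → X → ℝ≥0∞) : Prop :=
  ∀ f : X → ℝ, Continuous f → HasCompactSupport f →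
    ∃ (K : Set X) (lp lm : ℕ → Measure X), IsCompact K ∧ tsupport f ⊆ K ∧
      (∀ j, lp j ∈ Eplus κ ∧ lm j ∈ Eplus κ) ∧
      (∀ j x, pot κ (lp j) x ≠ ⊤ ∨ pot κ (lm j) x ≠ ⊤) ∧
      (∀ j, Continuous (spot κ (lp j) (lm j))) ∧
      (∀ j, tsupport (spot κ (lp j) (lm j)) ⊆ K) ∧
      TendstoUniformly (fun j => spot κ (lp j) (lm j)) f atTop


set_option linter.unusedSectionVars false

section

variable {X : Type*} [TopologicalSpace X] [T2Space X] [LocallyCompactSpace X]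
  [MeasurableSpace X] [BorelSpace X] [SecondCountableTopology X]
  {κ : X → X → ℝ≥0∞}

lemma isRadon_of_isLocallyFinite (μ : Measure X) [IsLocallyFiniteMeasure μ] : IsRadon μ :=
  ⟨inferInstance, inferInstance⟩

lemma IsKernel.measurable_pot (hker : IsKernel κ) (μ : Measure X) [SFinite μ] :
    Measurable (pot κ μ) :=
  hker.lsc.measurable.lintegral_prod_right'

lemma IsKernel.lowerSemicontinuous_pot (hker : IsKernel κ) (μ : Measure X) :
    LowerSemicontinuous (pot κ μ) := by
  have hmeas (x : X) : Measurable (κ x) := hker.lsc.measurable.comp measurable_prodMk_left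
  rw [lowerSemicontinuous_iff_le_liminf]
  intro x
  refine le_trans (lintegral_mono fun y => ?_) (lintegral_liminf_le hmeas)
  have hc : Continuous fun x : X => (x, y) := by fun_prop
  have hy : LowerSemicontinuous fun x => κ x y := hker.lsc.comp hc
  exact lowerSemicontinuous_iff_le_liminf.1 hy x

lemma energy_comm (hker : IsKernel κ) (μ ν : Measure X) [SFinite μ] [SFinite ν] :
    energy κ μ ν = energy κ ν μ := by
  unfold energy pot
  rw [lintegral_lintegral_swap hker.lsc.measurable.aemeasurable]
  simp_rw [fun x y => hker.symm x y]

lemma energy_add_left (μ ν σ : Measure X) :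
    energy κ (μ + ν) σ = energy κ μ σ + energy κ ν σ := lintegral_add_measure _ _ _

lemma energy_smul_left (c : ℝ≥0) (μ σ : Measure X) :
    energy κ (c • μ) σ = c * energy κ μ σ := by
  unfold energy
  rw [lintegral_smul_measure, ENNReal.smul_def, smul_eq_mul]

lemma energy_zero_left (σ : Measure X) : energy κ 0 σ = 0 := lintegral_zero_measure _

lemma energy_add_right (hker : IsKernel κ) (σ μ ν : Measure X) [SFinite μ] :
    energy κ σ (μ + ν) = energy κ σ μ + energy κ σ ν := by
  have h : pot κ (μ + ν) = fun x => pot κ μ x + pot κ ν x :=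
    funext fun x => lintegral_add_measure _ _ _
  unfold energy
  rw [h, lintegral_add_left (hker.measurable_pot μ)]

lemma energy_smul_right (hker : IsKernel κ) (c : ℝ≥0) (σ μ : Measure X) [SFinite μ] :
    energy κ σ (c • μ) = c * energy κ σ μ := by
  have h : pot κ (c • μ) = fun x => c * pot κ μ x :=
    funext fun x => by
      unfold pot
      rw [lintegral_smul_measure, ENNReal.smul_def, smul_eq_mul]
  unfold energy
  rw [h, lintegral_const_mul _ (hker.measurable_pot μ)]

lemma energy_ne_top (hE : EnergyPrinciple κ) {μ ν : Measure X} (hμ : μ ∈ Eplus κ)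
    (hν : ν ∈ Eplus κ) : energy κ μ ν ≠ ⊤ := by
  intro h
  have h1 := (hE μ hμ ν hν).1
  rw [h, ENNReal.mul_top two_ne_zero] at h1
  exact (ENNReal.add_lt_top.2 ⟨hμ.2, hν.2⟩).ne (top_le_iff.1 h1)

lemma zero_mem_Eplus : (0 : Measure X) ∈ Eplus κ :=
  ⟨isRadon_of_isLocallyFinite 0, by simp [energy_zero_left]⟩

lemma add_mem_Eplus (hker : IsKernel κ) (hE : EnergyPrinciple κ) {μ ν : Measure X}
    (hμ : μ ∈ Eplus κ) (hν : ν ∈ Eplus κ) : μ + ν ∈ Eplus κ := by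
  have := hμ.1.2
  have := hν.1.2
  have : IsLocallyFiniteMeasure (μ + ν) := by
    refine ⟨fun x => ?_⟩
    obtain ⟨U, hU, hUμ⟩ := μ.finiteAt_nhds x
    obtain ⟨V, hV, hVν⟩ := ν.finiteAt_nhds x
    refine ⟨U ∩ V, inter_mem hU hV, ?_⟩
    rw [Measure.add_apply]
    exact ENNReal.add_lt_top.2 ⟨(measure_mono inter_subset_left).trans_lt hUμ,
      (measure_mono inter_subset_right).trans_lt hVν⟩
  refine ⟨isRadon_of_isLocallyFinite _, ?_⟩
  rw [energy_add_left, energy_add_right hker, energy_add_right hker]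
  simp [lt_top_iff_ne_top, energy_ne_top hE, hμ, hν]

lemma smul_mem_Eplus (hker : IsKernel κ) (c : ℝ≥0) {μ : Measure X}
    (hμ : μ ∈ Eplus κ) : c • μ ∈ Eplus κ := by
  have := hμ.1.2
  refine ⟨isRadon_of_isLocallyFinite _, ?_⟩
  rw [energy_smul_left, energy_smul_right hker]
  exact ENNReal.mul_lt_top ENNReal.coe_lt_top (ENNReal.mul_lt_top ENNReal.coe_lt_top hμ.2)

lemma concOn_iff {μ : Measure X} {A : Set X} : ConcOn μ A ↔ μ Aᶜ = 0 := by
  constructor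
  · intro h
    refine measure_null_of_locally_null _ fun x _ => ?_
    obtain ⟨K, hK, hx⟩ := exists_compact_mem_nhds x
    exact ⟨Aᶜ ∩ K, inter_mem self_mem_nhdsWithin (mem_nhdsWithin_of_mem_nhds hx), h.2 K hK⟩
  · intro h
    refine ⟨?_, fun K _ => measure_mono_null inter_subset_left h⟩
    exact (NullMeasurableSet.of_null h).of_compl

lemma add_mem_EplusOn (hker : IsKernel κ) (hE : EnergyPrinciple κ) {A : Set X} {μ ν : Measure X}
    (hμ : μ ∈ EplusOn κ A) (hν : ν ∈ EplusOn κ A) : μ + ν ∈ EplusOn κ A := by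
  refine ⟨add_mem_Eplus hker hE hμ.1 hν.1, concOn_iff.2 ?_⟩
  simp [concOn_iff.1 hμ.2, concOn_iff.1 hν.2]

lemma smul_mem_EplusOn (hker : IsKernel κ) (c : ℝ≥0) {A : Set X} {μ : Measure X}
    (hμ : μ ∈ EplusOn κ A) : c • μ ∈ EplusOn κ A := by
  refine ⟨smul_mem_Eplus hker c hμ.1, concOn_iff.2 ?_⟩
  simp [concOn_iff.1 hμ.2]

lemma EplusOn_mono {A B : Set X} (hAB : A ⊆ B) : EplusOn κ A ⊆ EplusOn κ B := fun _ h =>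
  ⟨h.1, concOn_iff.2 (measure_mono_null (compl_subset_compl.2 hAB) (concOn_iff.1 h.2))⟩

lemma innerCap_eq_zero_iff {A : Set X} :
    innerCap κ A = 0 ↔ ∀ σ ∈ EplusOn κ A, σ univ ≠ 1 := by
  simp only [innerCap, ENNReal.inv_eq_zero, iInf_eq_top]
  constructor
  · intro h σ hσ h1
    exact hσ.1.2.ne (h σ ⟨hσ, h1⟩)
  · rintro h σ ⟨hσ, h1⟩
    exact absurd h1 (h σ hσ)

/-- A measure of finite energy does not charge measurable sets of inner capacity zero. -/
lemma measure_eq_zero_of_innerCap_eq_zero (hker : IsKernel κ) {μ : Measure X}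
    (hμ : μ ∈ Eplus κ) {S : Set X} (hS : MeasurableSet S) (hcap : innerCap κ S = 0) :
    μ S = 0 := by
  have := hμ.1.1
  have := hμ.1.2
  by_contra hne
  obtain ⟨K, hKS, hK, hpos⟩ := hS.exists_lt_isCompact (pos_iff_ne_zero.2 hne)
  have hKfin : μ K ≠ ⊤ := hK.measure_ne_top
  have hσ : μ.restrict K ∈ Eplus κ := by
    refine ⟨isRadon_of_isLocallyFinite _, lt_of_le_of_lt ?_ hμ.2⟩
    exact lintegral_mono' Measure.restrict_le_self
      fun x => lintegral_mono' Measure.restrict_le_self le_rfl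
  refine innerCap_eq_zero_iff.1 hcap ((μ K)⁻¹.toNNReal • μ.restrict K)
    (smul_mem_EplusOn hker _ ⟨hσ, concOn_iff.2 ?_⟩) ?_
  · rw [Measure.restrict_apply hS.compl]
    have : Sᶜ ∩ K = ∅ := by
      ext x; simp only [mem_inter_iff, mem_compl_iff, mem_empty_iff_false, iff_false]
      exact fun h => h.1 (hKS h.2)
    simp [this]
  · have : (μ K)⁻¹ ≠ ⊤ := by simpa using hpos.ne'
    rw [Measure.smul_apply, ENNReal.smul_def, Measure.restrict_apply_univ,
      ENNReal.coe_toNNReal this, smul_eq_mul, ENNReal.inv_mul_cancel hpos.ne' hKfin]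

/-- A set carrying a Radon measure contains a σ-compact set carrying it. -/
lemma exists_isSigmaCompact_measure_compl_eq_zero {μ : Measure X} [IsLocallyFiniteMeasure μ]
    {A : Set X} (hA : μ Aᶜ = 0) : ∃ T ⊆ A, IsSigmaCompact T ∧ μ Tᶜ = 0 := by
  have hS := measurableSet_toMeasurable μ Aᶜ
  set S := (toMeasurable μ Aᶜ)ᶜ with hSdef
  have hSA : S ⊆ A := compl_subset_comm.1 (subset_toMeasurable μ Aᶜ)
  have hSmeas : MeasurableSet S := hS.compl
  have hSnull : μ.toFinite Sᶜ = 0 := by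
    apply toFinite_absolutelyContinuous μ
    rw [hSdef, compl_compl, measure_toMeasurable, hA]
  have hK (n : ℕ) : ∃ K ⊆ S, IsCompact K ∧ μ.toFinite (S \ K) < ((n : ℝ≥0∞) + 1)⁻¹ :=
    hSmeas.exists_isCompact_sdiff_lt (measure_ne_top _ _) (by simp)
  choose K hKS hKc hKlt using hK
  refine ⟨⋃ n, K n, iUnion_subset fun n => (hKS n).trans hSA,
    isSigmaCompact_iUnion_of_isCompact _ hKc, absolutelyContinuous_toFinite μ ?_⟩
  refine le_antisymm (ENNReal.le_of_forall_pos_le_add fun ε hε _ => ?_) bot_le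
  obtain ⟨n, hn⟩ := ENNReal.exists_inv_nat_lt (ENNReal.coe_pos.2 hε).ne'
  calc μ.toFinite (⋃ n, K n)ᶜ ≤ μ.toFinite (Sᶜ ∪ (S \ K n)) := by
        refine measure_mono fun x hx => ?_
        simp only [mem_compl_iff, mem_iUnion, not_exists] at hx
        by_cases h : x ∈ S
        · exact Or.inr ⟨h, hx n⟩
        · exact Or.inl h
    _ ≤ μ.toFinite Sᶜ + μ.toFinite (S \ K n) := measure_union_le _ _
    _ ≤ 0 + ε := by
        rw [hSnull]
        gcongr
        refine (hKlt n).le.trans (le_trans ?_ hn.le)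
        gcongr
        exact le_self_add

lemma dirac_mem_Eplus {x : X} (hx : κ x x ≠ ⊤) : Measure.dirac x ∈ Eplus κ := by
  refine ⟨isRadon_of_isLocallyFinite _, ?_⟩
  simpa [energy, pot, lt_top_iff_ne_top] using hx

/-- The energy principle forces the kernel to be positive on the diagonal. -/
lemma EnergyPrinciple.diag_pos (hE : EnergyPrinciple κ) (x : X) : 0 < κ x x := by
  by_contra h
  have h0 : κ x x = 0 := by simpa using h
  have hen : energy κ (Measure.dirac x) (Measure.dirac x) = 0 := by simpa [energy, pot] using h0
  have := (hE 0 zero_mem_Eplus (Measure.dirac x) (dirac_mem_Eplus (by simp [h0]))).2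
    (by rw [energy_zero_left, energy_zero_left, hen]; simp)
  exact NeZero.ne (Measure.dirac x) this.symm

/-- Measures of uniformly bounded energy are uniformly bounded on each compact set. -/
lemma exists_measure_compact_le (hker : IsKernel κ) (hE : EnergyPrinciple κ) {M : ℝ≥0∞}
    (hM : M ≠ ⊤) {K : Set X} (hK : IsCompact K) :
    ∃ C : ℝ≥0∞, C ≠ ⊤ ∧ ∀ ν : Measure X, energy κ ν ν ≤ M → ν K ≤ C := by
  refine hK.induction_on (p := fun K => ∃ C : ℝ≥0∞, C ≠ ⊤ ∧ ∀ ν : Measure X,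
    energy κ ν ν ≤ M → ν K ≤ C) ⟨0, by simp, by simp⟩ ?_ ?_ ?_
  · rintro s t hst ⟨C, hC, h⟩
    exact ⟨C, hC, fun ν hν => (measure_mono hst).trans (h ν hν)⟩
  · rintro s t ⟨C, hC, h⟩ ⟨D, hD, h'⟩
    exact ⟨C + D, by simp [hC, hD], fun ν hν =>
      (measure_union_le s t).trans (add_le_add (h ν hν) (h' ν hν))⟩
  · intro x _
    obtain ⟨c, hc0, hc⟩ := exists_between (hE.diag_pos x)
    have hmem : {p : X × X | c < κ p.1 p.2} ∈ 𝓝 (x, x) := hker.lsc (x, x) c hc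
    rw [nhds_prod_eq, mem_prod_self_iff] at hmem
    obtain ⟨V, hV, hVc⟩ := hmem
    obtain ⟨U, hUV, hU, hxU⟩ := mem_nhds_iff.1 hV
    refine ⟨U, mem_nhdsWithin_of_mem_nhds (hU.mem_nhds hxU), 1 + M / c, ?_, fun ν hν => ?_⟩
    · exact ENNReal.add_ne_top.2 ⟨by simp, ENNReal.div_ne_top hM hc0.ne'⟩
    · rcases le_total (ν U) 1 with h | h
      · exact h.trans le_self_add
      · refine le_trans ?_ le_add_self
        rw [ENNReal.le_div_iff_mul_le (Or.inl hc0.ne') (Or.inl hc.ne_top)]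
        calc ν U * c ≤ (ν U * c) * ν U := le_mul_of_one_le_right bot_le h
          _ = ∫⁻ _ in U, ∫⁻ _ in U, c ∂ν ∂ν := by simp [mul_comm]
          _ ≤ ∫⁻ x in U, pot κ ν x ∂ν := by
            refine setLIntegral_mono' hU.measurableSet fun y hy => ?_
            refine le_trans ?_ (setLIntegral_le_lintegral U _)
            exact setLIntegral_mono' hU.measurableSet fun z hz =>
              (hVc (mk_mem_prod (hUV hy) (hUV hz))).le
          _ ≤ energy κ ν ν := setLIntegral_le_lintegral _ _
          _ ≤ M := hν

open CompactlySupported in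
/-- A vaguely bounded sequence of Radon measures converges vaguely along an ultrafilter. -/
lemma exists_vagueConv_ultrafilter {ι : Type*} (U : Ultrafilter ι) (m : ι → Measure X)
    (hm : ∀ i, IsLocallyFiniteMeasure (m i))
    (hb : ∀ K : Set X, IsCompact K → ∃ C : ℝ≥0∞, C ≠ ⊤ ∧ ∀ i, m i K ≤ C) :
    ∃ ν : Measure X, IsLocallyFiniteMeasure ν ∧ VagueConv (U : Filter ι) m ν := by
  have hlim (f : C_c(X, ℝ)) : ∃ l, Tendsto (fun i => ∫ x, f x ∂(m i)) U (𝓝 l) := by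
    obtain ⟨C, hC, hCm⟩ := hb _ f.hasCompactSupport.isCompact
    obtain ⟨B, hB⟩ := f.hasCompactSupport.exists_bound_of_continuous f.continuous
    have hbound (i : ι) : ∫ x, f x ∂(m i) ∈ Icc (-(|B| * C.toReal)) (|B| * C.toReal) := by
      rw [mem_Icc, ← abs_le, ← Real.norm_eq_abs,
        ← setIntegral_eq_integral_of_forall_compl_eq_zero (s := tsupport f)
          fun x hx => image_eq_zero_of_notMem_tsupport hx]
      have hfin : m i (tsupport f) < ⊤ := (hCm i).trans_lt hC.lt_top
      refine (norm_setIntegral_le_of_norm_le_const hfin fun x _ =>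
        (hB x).trans (le_abs_self B)).trans ?_
      exact mul_le_mul_of_nonneg_left (ENNReal.toReal_mono hC (hCm i)) (abs_nonneg B)
    obtain ⟨l, -, hl⟩ := isCompact_Icc.ultrafilter_le_nhds (U.map fun i => ∫ x, f x ∂(m i))
      (le_principal_iff.2 (Filter.mem_map.2 (Filter.Eventually.of_forall hbound)))
    exact ⟨l, hl⟩
  choose L hL using hlim
  let Λ : C_c(X, ℝ) →ₚ[ℝ] ℝ := PositiveLinearMap.mk₀
    { toFun := L
      map_add' := fun f g => by
        refine tendsto_nhds_unique (hL (f + g)) (((hL f).add (hL g)).congr fun i => ?_)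
        exact (integral_add f.integrable g.integrable).symm
      map_smul' := fun c f => by
        refine tendsto_nhds_unique (hL (c • f)) (((hL f).const_mul c).congr fun i => ?_)
        exact (integral_const_mul c _).symm }
    fun f hf => ge_of_tendsto (hL f) (Filter.Eventually.of_forall fun i => integral_nonneg hf)
  refine ⟨RealRMK.rieszMeasure Λ, inferInstance, fun f hf hfc => ?_⟩
  have := RealRMK.integral_rieszMeasure Λ ⟨⟨f, hf⟩, hfc⟩
  exact (hL ⟨⟨f, hf⟩, hfc⟩).trans_eq (congrArg 𝓝 this.symm)

/-- Integrals of nonnegative lower semicontinuous functions are lower semicontinuous with respect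
to vague convergence. -/
lemma lintegral_le_of_vagueConv {ι : Type*} {F : Filter ι} [F.NeBot] {m : ι → Measure X}
    {ν : Measure X} (hm : ∀ i, IsLocallyFiniteMeasure (m i)) [IsLocallyFiniteMeasure ν]
    (hconv : VagueConv F m ν) {g : X → ℝ≥0∞} (hg : LowerSemicontinuous g) {B : ℝ≥0∞}
    (hB : ∀ i, ∫⁻ x, g x ∂(m i) ≤ B) : ∫⁻ x, g x ∂ν ≤ B := by
  rcases eq_or_ne B ⊤ with rfl | hBtop
  · exact le_top
  let 𝓕 : Set (X → ℝ≥0∞) := {h | h ≤ g ∧ ∃ φ : X → ℝ, Continuous φ ∧ HasCompactSupport φ ∧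
    (∀ x, 0 ≤ φ x) ∧ h = fun x => ENNReal.ofReal (φ x)}
  have hcont (h) (hh : h ∈ 𝓕) : Continuous h := by
    obtain ⟨-, φ, hφ, -, -, rfl⟩ := hh
    exact ENNReal.continuous_ofReal.comp hφ
  have hint (h) (hh : h ∈ 𝓕) : ∫⁻ x, h x ∂ν ≤ B := by
    obtain ⟨hle, φ, hφ, hφc, hφ0, rfl⟩ := hh
    rw [← ofReal_integral_eq_lintegral_ofReal (hφ.integrable_of_hasCompactSupport hφc)
      (Filter.Eventually.of_forall hφ0)]
    refine ENNReal.ofReal_le_of_le_toReal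
      (le_of_tendsto (hconv φ hφ hφc) (Filter.Eventually.of_forall fun i => ?_))
    rw [← ENNReal.ofReal_le_iff_le_toReal hBtop, ofReal_integral_eq_lintegral_ofReal
      (hφ.integrable_of_hasCompactSupport hφc) (Filter.Eventually.of_forall hφ0)]
    exact (lintegral_mono hle).trans (hB i)
  have hlub : IsLUB 𝓕 g := by
    refine ⟨fun h hh => hh.1, fun u hu x => le_of_forall_lt fun t ht => ?_⟩
    obtain ⟨s, hts, hs⟩ := exists_between ht
    lift s to ℝ≥0 using hs.ne_top
    have hopen : IsOpen {y | (s : ℝ≥0∞) < g y} := hg.isOpen_preimage _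
    obtain ⟨φ, hφ1, hφ0, hφc, hφI⟩ := exists_continuous_one_zero_of_isCompact
      (isCompact_singleton (x := x)) hopen.isClosed_compl (by simpa using hs)
    have hmem : (fun y => ENNReal.ofReal (s * φ y)) ∈ 𝓕 := by
      refine ⟨fun y => ?_, fun y => s * φ y, by fun_prop, hφc.mul_left,
        fun y => mul_nonneg s.2 (hφI y).1, rfl⟩
      by_cases hy : (s : ℝ≥0∞) < g y
      · refine le_trans ?_ hy.le
        rw [← ENNReal.ofReal_coe_nnreal]
        exact ENNReal.ofReal_le_ofReal (mul_le_of_le_one_right s.2 (hφI y).2)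
      · have : φ y = 0 := hφ0 hy
        simp [this]
    have hx : φ x = 1 := hφ1 rfl
    have := hu hmem x
    simp only [hx, mul_one, ENNReal.ofReal_coe_nnreal] at this
    exact hts.trans_le this
  obtain ⟨𝓒, h𝓒, h𝓒c, h𝓒lub⟩ := exists_countable_lowerSemicontinuous_isLUB
    (fun h hh => (hcont h hh).lowerSemicontinuous) hlub
  have hzero : (0 : X → ℝ≥0∞) ∈ 𝓕 :=
    ⟨fun x => bot_le, 0, continuous_const, HasCompactSupport.zero, fun _ => le_rfl, by ext; simp⟩
  obtain ⟨u, hu⟩ := (h𝓒c.insert 0).exists_eq_range (insert_nonempty _ _)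
  have hu𝓕 (n : ℕ) : u n ∈ 𝓕 := by
    have : u n ∈ insert 0 𝓒 := hu ▸ mem_range_self n
    rcases this with h | h
    · exact h ▸ hzero
    · exact h𝓒 h
  have hsup : SupClosed 𝓕 := by
    rintro _ ⟨hle, φ, hφ, hφc, hφ0, rfl⟩ _ ⟨hle', ψ, hψ, hψc, hψ0, rfl⟩
    refine ⟨sup_le hle hle', fun x => max (φ x) (ψ x), hφ.max hψ,
      hφc.comp₂_left hψc (max_self 0), fun x => le_max_of_le_left (hφ0 x), ?_⟩
    ext x
    simp
  have hps (n : ℕ) : partialSups u n ∈ 𝓕 := by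
    induction n with
    | zero => simpa using hu𝓕 0
    | succ n ih => simpa using hsup ih (hu𝓕 (n + 1))
  have hgeq : g = fun x => ⨆ n, partialSups u n x := by
    have h1 : g ≤ ⨆ n, partialSups u n := by
      refine h𝓒lub.2 fun h hh => ?_
      have : h ∈ range u := hu ▸ mem_insert_of_mem _ hh
      obtain ⟨n, rfl⟩ := this
      exact (le_partialSups u n).trans (le_iSup (fun n => partialSups u n) n)
    refine le_antisymm (h1.trans_eq ?_) fun x => iSup_le fun n => (hps n).1 x
    ext x; simp
  rw [hgeq, lintegral_iSup (fun n => (hcont _ (hps n)).measurable)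
    fun i j hij => (partialSups u).monotone hij]
  exact iSup_le fun n => hint _ (hps n)

/-- A strong Cauchy sequence of bounded energy converges strongly. -/
lemma exists_strong_limit (hker : IsKernel κ) (hE : EnergyPrinciple κ) (hC : Consistent κ)
    {m : ℕ → Measure X} (hm : ∀ j, m j ∈ Eplus κ) {M : ℝ≥0∞} (hM : M ≠ ⊤)
    (hbound : ∀ j, energy κ (m j) (m j) ≤ M) (hcauchy : StrongCauchy κ atTop m) :
    ∃ ν ∈ Eplus κ, Tendsto (fun j => strDist κ (m j) ν) atTop (𝓝 0) := by
  have hlf (j : ℕ) : IsLocallyFiniteMeasure (m j) := (hm j).1.2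
  obtain ⟨ν, hν, hconv⟩ := exists_vagueConv_ultrafilter (hyperfilter ℕ) m hlf fun K hK => by
    obtain ⟨C, hC, h⟩ := exists_measure_compact_le hker hE hM hK
    exact ⟨C, hC, fun i => h _ (hbound i)⟩
  refine ⟨ν, ⟨isRadon_of_isLocallyFinite ν, lt_of_le_of_lt ?_ hM.lt_top⟩,
    hC ℕ atTop m inferInstance hm hcauchy ν
      ⟨hyperfilter ℕ, Nat.hyperfilter_le_atTop, inferInstance, hconv⟩⟩
  have hij (i j : ℕ) : energy κ (m i) (m j) ≤ M := by
    have h := (hE _ (hm i) _ (hm j)).1.trans (add_le_add (hbound i) (hbound j))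
    rw [← two_mul] at h
    exact (ENNReal.mul_le_mul_iff_right two_ne_zero ENNReal.ofNat_ne_top).1 h
  refine lintegral_le_of_vagueConv hlf hconv (hker.lowerSemicontinuous_pot ν) fun i => ?_
  change energy κ (m i) ν ≤ M
  rw [energy_comm hker]
  exact lintegral_le_of_vagueConv hlf hconv (hker.lowerSemicontinuous_pot (m i)) fun j => hij j i

/-- The mutual energy as a real number. -/
noncomputable def realEnergy (κ : X → X → ℝ≥0∞) (μ ν : Measure X) : ℝ := (energy κ μ ν).toReal

lemma realEnergy_comm (hker : IsKernel κ) {μ ν : Measure X} (hμ : μ ∈ Eplus κ)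
    (hν : ν ∈ Eplus κ) : realEnergy κ μ ν = realEnergy κ ν μ := by
  have := hμ.1.2
  have := hν.1.2
  rw [realEnergy, realEnergy, energy_comm hker]

lemma realEnergy_add_left (hE : EnergyPrinciple κ) {μ ν σ : Measure X}
    (hμ : μ ∈ Eplus κ) (hν : ν ∈ Eplus κ) (hσ : σ ∈ Eplus κ) :
    realEnergy κ (μ + ν) σ = realEnergy κ μ σ + realEnergy κ ν σ := by
  rw [realEnergy, energy_add_left,
    ENNReal.toReal_add (energy_ne_top hE hμ hσ) (energy_ne_top hE hν hσ)]
  rfl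

lemma realEnergy_add_right (hker : IsKernel κ) (hE : EnergyPrinciple κ) {μ ν σ : Measure X}
    (hμ : μ ∈ Eplus κ) (hν : ν ∈ Eplus κ) (hσ : σ ∈ Eplus κ) :
    realEnergy κ σ (μ + ν) = realEnergy κ σ μ + realEnergy κ σ ν := by
  have := hμ.1.2
  rw [realEnergy, energy_add_right hker,
    ENNReal.toReal_add (energy_ne_top hE hσ hμ) (energy_ne_top hE hσ hν)]
  rfl

lemma realEnergy_smul_left (c : ℝ≥0) (μ σ : Measure X) :
    realEnergy κ (c • μ) σ = c * realEnergy κ μ σ := by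
  rw [realEnergy, energy_smul_left, ENNReal.toReal_mul, ENNReal.coe_toReal]
  rfl

lemma realEnergy_smul_right (hker : IsKernel κ) (c : ℝ≥0) (σ : Measure X) {μ : Measure X}
    (hμ : μ ∈ Eplus κ) : realEnergy κ σ (c • μ) = c * realEnergy κ σ μ := by
  have := hμ.1.2
  rw [realEnergy, energy_smul_right hker, ENNReal.toReal_mul, ENNReal.coe_toReal]
  rfl

lemma realEnergy_nonneg (μ ν : Measure X) : 0 ≤ realEnergy κ μ ν := ENNReal.toReal_nonneg

/-- The square of the strong distance. -/
noncomputable def sqDist (κ : X → X → ℝ≥0∞) (μ ν : Measure X) : ℝ :=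
  realEnergy κ μ μ - 2 * realEnergy κ μ ν + realEnergy κ ν ν

lemma sqDist_nonneg (hE : EnergyPrinciple κ) {μ ν : Measure X} (hμ : μ ∈ Eplus κ)
    (hν : ν ∈ Eplus κ) : 0 ≤ sqDist κ μ ν := by
  have h := ENNReal.toReal_mono (ENNReal.add_ne_top.2 ⟨hμ.2.ne, hν.2.ne⟩) (hE μ hμ ν hν).1
  rw [ENNReal.toReal_mul, ENNReal.toReal_add hμ.2.ne hν.2.ne] at h
  simp only [ENNReal.toReal_ofNat] at h
  unfold sqDist realEnergy
  linarith

lemma eq_of_sqDist_nonpos (hE : EnergyPrinciple κ) {μ ν : Measure X} (hμ : μ ∈ Eplus κ)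
    (hν : ν ∈ Eplus κ) (h : sqDist κ μ ν ≤ 0) : μ = ν := by
  have h0 := le_antisymm h (sqDist_nonneg hE hμ hν)
  refine (hE μ hμ ν hν).2 ?_
  rw [← ENNReal.toReal_eq_toReal_iff' (ENNReal.mul_ne_top (by simp) (energy_ne_top hE hμ hν))
    (ENNReal.add_ne_top.2 ⟨hμ.2.ne, hν.2.ne⟩), ENNReal.toReal_mul,
    ENNReal.toReal_add hμ.2.ne hν.2.ne]
  simp only [ENNReal.toReal_ofNat]
  unfold sqDist realEnergy at h0
  linarith

lemma sq_strDist (hE : EnergyPrinciple κ) {μ ν : Measure X} (hμ : μ ∈ Eplus κ)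
    (hν : ν ∈ Eplus κ) : strDist κ μ ν ^ 2 = sqDist κ μ ν :=
  Real.sq_sqrt (sqDist_nonneg hE hμ hν)

/-- The Cauchy–Schwarz inequality for the energy form. -/
lemma sq_realEnergy_sub_le (hker : IsKernel κ) (hE : EnergyPrinciple κ) {σ μ ν : Measure X}
    (hσ : σ ∈ Eplus κ) (hμ : μ ∈ Eplus κ) (hν : ν ∈ Eplus κ) :
    (realEnergy κ σ μ - realEnergy κ σ ν) ^ 2 ≤ realEnergy κ σ σ * sqDist κ μ ν := by
  have key {a b : Measure X} (ha : a ∈ Eplus κ) (hb : b ∈ Eplus κ) (t : ℝ≥0) :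
      0 ≤ realEnergy κ σ σ * (t * t) + 2 * (realEnergy κ σ a - realEnergy κ σ b) * t
        + sqDist κ a b := by
    have hs := smul_mem_Eplus hker t hσ
    have h := sqDist_nonneg hE (add_mem_Eplus hker hE hs ha) hb
    rw [sqDist, realEnergy_add_left hE hs ha (add_mem_Eplus hker hE hs ha),
      realEnergy_add_right hker hE hs ha hs, realEnergy_add_right hker hE hs ha ha,
      realEnergy_add_left hE hs ha hb, realEnergy_smul_right hker _ _ hσ,
      realEnergy_smul_right hker _ _ hσ, realEnergy_smul_left, realEnergy_smul_left,
      realEnergy_smul_left, realEnergy_comm hker ha hσ] at h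
    unfold sqDist
    linarith
  have hsymm : sqDist κ ν μ = sqDist κ μ ν := by
    unfold sqDist
    rw [realEnergy_comm hker hν hμ]
    ring
  have h := discrim_le_zero (a := realEnergy κ σ σ)
    (b := 2 * (realEnergy κ σ μ - realEnergy κ σ ν)) (c := sqDist κ μ ν) fun t => by
      rcases le_total 0 t with ht | ht
      · exact key hμ hν ⟨t, ht⟩
      · have := key hν hμ ⟨-t, neg_nonneg.2 ht⟩
        rw [hsymm] at this
        change 0 ≤ realEnergy κ σ σ * (-t * -t)
          + 2 * (realEnergy κ σ ν - realEnergy κ σ μ) * -t + sqDist κ μ ν at this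
        linarith
  unfold discrim at h
  linarith

section StrongLimit

variable {m : ℕ → Measure X} {ν : Measure X}

lemma tendsto_sqDist (hE : EnergyPrinciple κ) (hm : ∀ j, m j ∈ Eplus κ) (hν : ν ∈ Eplus κ)
    (h : Tendsto (fun j => strDist κ (m j) ν) atTop (𝓝 0)) :
    Tendsto (fun j => sqDist κ (m j) ν) atTop (𝓝 0) := by
  have := h.pow 2
  simpa [sq_strDist hE (hm _) hν] using this

lemma tendsto_realEnergy (hker : IsKernel κ) (hE : EnergyPrinciple κ)
    (hm : ∀ j, m j ∈ Eplus κ) (hν : ν ∈ Eplus κ)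
    (h : Tendsto (fun j => strDist κ (m j) ν) atTop (𝓝 0)) {σ : Measure X}
    (hσ : σ ∈ Eplus κ) :
    Tendsto (fun j => realEnergy κ σ (m j)) atTop (𝓝 (realEnergy κ σ ν)) := by
  rw [tendsto_iff_norm_sub_tendsto_zero]
  have h1 := (((tendsto_sqDist hE hm hν h).const_mul (realEnergy κ σ σ)).sqrt)
  rw [mul_zero, Real.sqrt_zero] at h1
  refine squeeze_zero (fun _ => norm_nonneg _) (fun j => ?_) h1
  rw [Real.norm_eq_abs]
  exact Real.abs_le_sqrt (sq_realEnergy_sub_le hker hE hσ (hm j) hν)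

lemma tendsto_realEnergy_self (hker : IsKernel κ) (hE : EnergyPrinciple κ)
    (hm : ∀ j, m j ∈ Eplus κ) (hν : ν ∈ Eplus κ)
    (h : Tendsto (fun j => strDist κ (m j) ν) atTop (𝓝 0)) :
    Tendsto (fun j => realEnergy κ (m j) (m j)) atTop (𝓝 (realEnergy κ ν ν)) := by
  have h1 := (tendsto_sqDist hE hm hν h).add
    (((tendsto_realEnergy hker hE hm hν h hν).const_mul 2).sub_const (realEnergy κ ν ν))
  convert h1 using 2 with j
  · rw [sqDist, realEnergy_comm hker hν (hm j)]
    ring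
  · ring

end StrongLimit

/-- The Gauss functional `‖ν‖² - 2κ(μ,ν)`. -/
noncomputable def gauss (κ : X → X → ℝ≥0∞) (μ ν : Measure X) : ℝ :=
  realEnergy κ ν ν - 2 * realEnergy κ μ ν

lemma gauss_add (hker : IsKernel κ) (hE : EnergyPrinciple κ) {μ ν σ : Measure X}
    (hμ : μ ∈ Eplus κ) (hν : ν ∈ Eplus κ) (hσ : σ ∈ Eplus κ) :
    gauss κ μ (ν + σ) = gauss κ μ ν + gauss κ μ σ + 2 * realEnergy κ σ ν := by
  unfold gauss
  rw [realEnergy_add_left hE hν hσ (add_mem_Eplus hker hE hν hσ),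
    realEnergy_add_right hker hE hν hσ hν, realEnergy_add_right hker hE hν hσ hσ,
    realEnergy_add_right hker hE hν hσ hμ, realEnergy_comm hker hν hσ]
  ring

lemma gauss_smul (hker : IsKernel κ) (c : ℝ≥0) (μ : Measure X) {ν : Measure X}
    (hν : ν ∈ Eplus κ) :
    gauss κ μ (c • ν) = c ^ 2 * realEnergy κ ν ν - 2 * c * realEnergy κ μ ν := by
  unfold gauss
  rw [realEnergy_smul_left, realEnergy_smul_right hker c ν hν, realEnergy_smul_right hker c μ hν]
  ring

/-- Existence of the minimizer of the Gauss functional in the strong closure of `E⁺_A`,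
together with its variational inequalities. -/
lemma exists_projection (hker : IsKernel κ) (hE : EnergyPrinciple κ) (hC : Consistent κ)
    {μ : Measure X} (hμ : μ ∈ Eplus κ) (A : Set X) :
    ∃ (m : ℕ → Measure X) (ν : Measure X), (∀ j, m j ∈ EplusOn κ A) ∧ ν ∈ Eplus κ ∧
      Tendsto (fun j => strDist κ (m j) ν) atTop (𝓝 0) ∧
      (∀ σ ∈ EplusOn κ A, realEnergy κ σ μ ≤ realEnergy κ σ ν) ∧
      realEnergy κ ν ν ≤ realEnergy κ μ ν := by
  have hbdd : BddBelow (gauss κ μ '' EplusOn κ A) := by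
    refine ⟨-realEnergy κ μ μ, ?_⟩
    rintro _ ⟨ν, hν, rfl⟩
    have := sqDist_nonneg hE hμ hν.1
    unfold sqDist at this
    unfold gauss
    linarith
  have hzero : (0 : Measure X) ∈ EplusOn κ A := ⟨zero_mem_Eplus, concOn_iff.2 (by simp)⟩
  set I := sInf (gauss κ μ '' EplusOn κ A)
  have hIle {ν : Measure X} (hν : ν ∈ EplusOn κ A) : I ≤ gauss κ μ ν :=
    csInf_le hbdd (mem_image_of_mem _ hν)
  have hex (j : ℕ) : ∃ ν ∈ EplusOn κ A, gauss κ μ ν < I + 1 / ((j : ℝ) + 1) := by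
    obtain ⟨_, ⟨ν, hν, rfl⟩, h⟩ := Real.lt_sInf_add_pos (s := gauss κ μ '' EplusOn κ A)
      ⟨_, mem_image_of_mem _ hzero⟩ (ε := 1 / ((j : ℝ) + 1)) (by positivity)
    exact ⟨ν, hν, h⟩
  choose m hm hmI using hex
  have hmE (j : ℕ) : m j ∈ Eplus κ := (hm j).1
  have hdist (i j : ℕ) : sqDist κ (m i) (m j) ≤ 2 * (1 / ((i : ℝ) + 1) + 1 / ((j : ℝ) + 1)) := by
    have h := hIle (smul_mem_EplusOn hker (1 / 2) (add_mem_EplusOn hker hE (hm i) (hm j)))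
    rw [gauss_smul hker _ _ (add_mem_Eplus hker hE (hmE i) (hmE j)),
      realEnergy_add_left hE (hmE i) (hmE j) (add_mem_Eplus hker hE (hmE i) (hmE j)),
      realEnergy_add_right hker hE (hmE i) (hmE j) (hmE i),
      realEnergy_add_right hker hE (hmE i) (hmE j) (hmE j),
      realEnergy_add_right hker hE (hmE i) (hmE j) hμ, realEnergy_comm hker (hmE j) (hmE i)] at h
    have hi := hmI i
    have hj := hmI j
    unfold gauss at hi hj
    unfold sqDist
    push_cast at h
    linarith
  have hcauchy : StrongCauchy κ atTop m := by
    intro ε hε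
    obtain ⟨N, hN⟩ := exists_nat_one_div_lt (K := ℝ) (show 0 < ε ^ 2 / 4 by positivity)
    refine ⟨Ici N, Ici_mem_atTop N, fun i hi j hj => ?_⟩
    refine lt_of_pow_lt_pow_left₀ 2 hε.le ?_
    rw [sq_strDist hE (hmE i) (hmE j)]
    have h1 := (Nat.one_div_le_one_div (α := ℝ) hi).trans_lt hN
    have h2 := (Nat.one_div_le_one_div (α := ℝ) hj).trans_lt hN
    linarith [hdist i j]
  have hbound (j : ℕ) :
      energy κ (m j) (m j) ≤ ENNReal.ofReal (2 + 4 * realEnergy κ μ μ) := by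
    rw [ENNReal.le_ofReal_iff_toReal_le (hmE j).2.ne
      (by linarith [realEnergy_nonneg (κ := κ) μ μ])]
    change realEnergy κ (m j) (m j) ≤ _
    have h0 : I ≤ 0 := by simpa [gauss, realEnergy, energy_zero_left, energy, pot] using hIle hzero
    have h1 : 1 / ((j : ℝ) + 1) ≤ 1 := by
      rw [div_le_one (by positivity)]
      linarith [Nat.cast_nonneg (α := ℝ) j]
    have h2 := hmI j
    have h3 := sqDist_nonneg hE (smul_mem_Eplus hker 2 hμ) (hmE j)
    rw [sqDist, realEnergy_smul_left, realEnergy_smul_right hker _ _ hμ,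
      realEnergy_smul_left] at h3
    unfold gauss at h2
    push_cast at h3
    linarith
  obtain ⟨ν, hν, hlim⟩ := exists_strong_limit hker hE hC hmE ENNReal.ofReal_ne_top hbound hcauchy
  have hinv : Tendsto (fun j : ℕ => -(1 / ((j : ℝ) + 1))) atTop (𝓝 0) := by
    simpa using (tendsto_one_div_add_atTop_nhds_zero_nat (𝕜 := ℝ)).neg
  have hlimσ {σ : Measure X} (hσ : σ ∈ Eplus κ) := tendsto_realEnergy hker hE hmE hν hlim hσ
  have hself := tendsto_realEnergy_self hker hE hmE hν hlim
  have hreal {a b : ℝ} (h : ∀ t : ℝ, 0 < t → t < 1 → 0 ≤ 2 * t * a + t ^ 2 * b) : 0 ≤ a := by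
    by_contra! ha
    obtain ⟨t, ht0, ht⟩ := exists_between (show 0 < min 1 (-a / (|b| + 1)) by
      have : 0 < -a / (|b| + 1) := div_pos (by linarith) (by positivity)
      exact lt_min one_pos this)
    have h1 := h t ht0 (ht.trans_le (min_le_left _ _))
    have h2 := ht.trans_le (min_le_right _ _)
    rw [lt_div_iff₀ (by positivity)] at h2
    nlinarith [le_abs_self b, abs_nonneg b]
  refine ⟨m, ν, hm, hν, hlim, fun σ hσ => ?_, ?_⟩
  · refine sub_nonneg.1 (hreal (b := realEnergy κ σ σ) fun t ht0 _ => ?_)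
    lift t to ℝ≥0 using ht0.le
    refine le_of_tendsto_of_tendsto' hinv
      ((((hlimσ hσ.1).sub_const _).const_mul (2 * (t : ℝ))).add_const _) fun j => ?_
    have h1 := hIle (add_mem_EplusOn hker hE (hm j) (smul_mem_EplusOn hker t hσ))
    rw [gauss_add hker hE hμ (hmE j) (smul_mem_Eplus hker t hσ.1), gauss_smul hker t μ hσ.1,
      realEnergy_smul_left, realEnergy_comm hker hμ hσ.1] at h1
    linarith [hmI j]
  · refine sub_nonneg.1 (hreal (b := realEnergy κ ν ν) fun t ht0 ht1 => ?_)
    refine le_of_tendsto_of_tendsto' hinv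
      ((((hlimσ hμ).sub hself).const_mul (2 * t)).add (hself.const_mul (t ^ 2))) fun j => ?_
    obtain ⟨s, hs⟩ : ∃ s : ℝ≥0, (s : ℝ) = 1 - t := ⟨⟨1 - t, by linarith⟩, rfl⟩
    have h1 := hIle (smul_mem_EplusOn hker s (hm j))
    rw [gauss_smul hker s μ (hmE j), hs] at h1
    have h2 := hmI j
    unfold gauss at h2
    linarith

/-- Any inner balayage onto `L` agrees with the projection `ν` once `L` carries the minimizing
sequence. -/
lemma IsInnerBal.eq_projection (hker : IsKernel κ) (hE : EnergyPrinciple κ)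
    {μ ν b : Measure X} {A A' L : Set X} {m : ℕ → Measure X} (hμ : μ ∈ Eplus κ)
    (hm : ∀ j, m j ∈ Eplus κ) (hmA' : ∀ j, m j A'ᶜ = 0) (hA' : MeasurableSet A')
    (hν : ν ∈ Eplus κ) (hlim : Tendsto (fun j => strDist κ (m j) ν) atTop (𝓝 0))
    (hvar : ∀ σ ∈ EplusOn κ A, realEnergy κ σ μ ≤ realEnergy κ σ ν)
    (hself : realEnergy κ ν ν ≤ realEnergy κ μ ν) (hA'L : A' ⊆ L) (hLA : L ⊆ A)
    (hb : IsInnerBal κ L μ b) : b = ν := by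
  have := hμ.1.2
  have := hν.1.2
  obtain ⟨⟨hbE, hbL⟩, hmin⟩ := hb
  have := hbE.1.2
  have hνL : ν ∈ InnerLam κ L μ := by
    refine ⟨hν, innerCap_eq_zero_iff.2 fun σ hσ h1 => ?_⟩
    have hσA : σ ∈ EplusOn κ A := EplusOn_mono (fun x hx => hLA hx.1) hσ
    have hlt : ∀ᵐ x ∂σ, pot κ ν x < pot κ μ x := by
      filter_upwards [compl_mem_ae_iff.2 (concOn_iff.1 hσ.2)] with x hx
      rw [compl_compl] at hx
      exact not_le.1 hx.2
    have hσ0 : σ ≠ 0 := by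
      rintro rfl
      simp at h1
    have h2 : energy κ σ ν < energy κ σ μ :=
      lintegral_strict_mono hσ0 (hker.measurable_pot μ).aemeasurable
        (energy_ne_top hE hσ.1 hν) hlt
    exact (hvar σ hσA).not_gt
      ((ENNReal.toReal_lt_toReal (energy_ne_top hE hσ.1 hν) (energy_ne_top hE hσ.1 hμ)).2 h2)
  have hlow : realEnergy κ μ ν ≤ realEnergy κ b ν := by
    refine le_of_tendsto_of_tendsto' (tendsto_realEnergy hker hE hm hν hlim hμ)
      (tendsto_realEnergy hker hE hm hν hlim hbE) fun j => ?_
    rw [realEnergy_comm hker hμ (hm j), realEnergy_comm hker hbE (hm j)]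
    refine ENNReal.toReal_mono (energy_ne_top hE (hm j) hbE) (lintegral_mono_ae ?_)
    have hnull : m j (A' ∩ {x | pot κ b x < pot κ μ x}) = 0 := by
      refine measure_eq_zero_of_innerCap_eq_zero hker (hm j)
        (hA'.inter (measurableSet_lt (hker.measurable_pot b) (hker.measurable_pot μ))) ?_
      refine innerCap_eq_zero_iff.2 fun σ hσ => innerCap_eq_zero_iff.1 hbL σ ?_
      refine EplusOn_mono ?_ hσ
      exact fun x hx => ⟨hA'L hx.1, not_le.2 hx.2⟩
    filter_upwards [compl_mem_ae_iff.2 hnull, compl_mem_ae_iff.2 (hmA' j)] with x hx hxA'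
    rw [compl_compl] at hxA'
    exact not_lt.1 fun h => hx ⟨hxA', h⟩
  have hup : realEnergy κ b b ≤ realEnergy κ b ν :=
    ENNReal.toReal_mono (energy_ne_top hE hbE hν) (lintegral_mono (hmin ν hνL))
  refine eq_of_sqDist_nonpos hE hbE hν ?_
  unfold sqDist
  linarith

end
/-- For second-countable `X`, every `μ ∈ E⁺` and `A ⊆ X` admit a σ-compact `A' ⊆ A`
with `κμ^{A'} = κμ^L = κμ^A` on `X` (hence `μ^{A'} = μ^L = μ^A`) for all `A' ⊆ L ⊆ A`. -/
theorem statement19 [SecondCountableTopology X] (κ : X → X → ℝ≥0∞) (hker : IsKernel κ)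
    (hE : EnergyPrinciple κ) (hC : Consistent κ) (hD : Domination κ) :
    ∀ μ ∈ Eplus κ, ∀ A : Set X,
      ∃ A' : Set X, A' ⊆ A ∧ IsSigmaCompact A' ∧
        ∀ L : Set X, A' ⊆ L → L ⊆ A →
          ∀ bA' bL bA : Measure X,
            IsInnerBal κ A' μ bA' → IsInnerBal κ L μ bL → IsInnerBal κ A μ bA →
              (∀ x, pot κ bA' x = pot κ bA x ∧ pot κ bL x = pot κ bA x) ∧
              bA' = bA ∧ bL = bA := by
  intro μ hμ A
  obtain ⟨m, ν, hm, hν, hlim, hvar, hself⟩ := exists_projection hker hE hC hμ A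
  have hT (j : ℕ) : ∃ T ⊆ A, IsSigmaCompact T ∧ m j Tᶜ = 0 := by
    have := (hm j).1.1.2
    exact exists_isSigmaCompact_measure_compl_eq_zero (concOn_iff.1 (hm j).2)
  choose T hTA hTσ hTm using hT
  have hσ : IsSigmaCompact (⋃ j, T j) := isSigmaCompact_iUnion T hTσ
  have hmeas : MeasurableSet (⋃ j, T j) := by
    obtain ⟨K, hK, hKT⟩ := hσ
    rw [← hKT]
    exact MeasurableSet.iUnion fun n => (hK n).measurableSet
  have hsub : ⋃ j, T j ⊆ A := iUnion_subset hTA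
  have hnull (j : ℕ) : m j (⋃ j, T j)ᶜ = 0 :=
    measure_mono_null (compl_subset_compl.2 (subset_iUnion T j)) (hTm j)
  have key {L : Set X} {b : Measure X} (h1 : ⋃ j, T j ⊆ L) (h2 : L ⊆ A)
      (hb : IsInnerBal κ L μ b) : b = ν :=
    hb.eq_projection hker hE hμ (fun j => (hm j).1) hnull hmeas hν hlim hvar hself h1 h2
  refine ⟨⋃ j, T j, hsub, hσ, fun L h1 h2 bA' bL bA hbA' hbL hbA => ?_⟩
  rw [key Subset.rfl hsub hbA', key h1 h2 hbL, key hsub Subset.rfl hbA]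
  exact ⟨fun _ => ⟨rfl, rfl⟩, rfl, rfl⟩

end Balayage
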